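/- arXiv:2204.05157 — 4 statements merged into one kernel-verified Lean document; each statement's English description precedes it below -/
import Mathlib

section
/- Let (Ω, μ) be a probability space carrying random variables X : Ω → 𝒳, Y : Ω → 𝒴 and A, Ã : Ω → Fin m, and let M : 𝒳 → 𝒴 be a measurable classifier and h : 𝒴 × 𝒴 → ℝ a measurable fairness function with 0 ≤ h(y, y') ≤ B for all y, y'. Suppose P(A = a) > 0 and P(Ã = a) > 0 for every a ∈ Fin m, that M is α-fair w.r.t. (X, Ã, Y) and h, and that there is η > 0 such that for every a ∈ Fin m and almost every (x, y) under the law of (X, Y), the regular conditional distributions satisfy |P(Ã = a | X = x, Y = y) − P(A = a | X = x, Y = y)| ≤ η. Then M is α'-fair w.r.t. (X, A, Y) and h, where α' = η·B / (min_{a ∈ Fin m} min{P(Ã = a), P(A = a)}) + α. -/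
open MeasureTheory ProbabilityTheory

/-- Disintegration: integrate a bounded function of `Z` over the event `A = a`. -/
theorem setIntegral_eq_condDistrib_aux
    {Ω 𝒵 : Type*} [MeasurableSpace Ω] [MeasurableSpace 𝒵]
    (μ : Measure Ω) [IsProbabilityMeasure μ] {m : ℕ} [NeZero m]
    (Z : Ω → 𝒵) (A : Ω → Fin m) (hZ : Measurable Z) (hA : Measurable A)
    (F : 𝒵 → ℝ) (hF : Measurable F) (C : ℝ) (hC : ∀ z, |F z| ≤ C) (a : Fin m) :
    ∫ ω in A ⁻¹' {a}, F (Z ω) ∂μ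
      = ∫ z, F z * (condDistrib A Z μ z {a}).toReal ∂(μ.map Z) := by
  have : IsProbabilityMeasure (μ.map Z) := Measure.isProbabilityMeasure_map hZ.aemeasurable
  have hG : Measurable (fun p : 𝒵 × Fin m => F p.1 * ({a} : Set (Fin m)).indicator (fun _ => (1:ℝ)) p.2) :=
    (hF.comp measurable_fst).mul
      ((measurable_const.indicator (measurableSet_singleton a)).comp measurable_snd)
  have e1 : ∫ ω in A ⁻¹' {a}, F (Z ω) ∂μ
      = ∫ p, F p.1 * ({a} : Set (Fin m)).indicator (fun _ => (1:ℝ)) p.2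
          ∂(μ.map (fun ω => (Z ω, A ω))) := by
    rw [integral_map (hZ.prodMk hA).aemeasurable hG.aestronglyMeasurable,
      ← integral_indicator (hA (measurableSet_singleton a))]
    congr 1
    ext ω
    by_cases hω : A ω = a <;> simp [Set.indicator, hω]
  rw [e1, ← compProd_map_condDistrib hA.aemeasurable, Measure.integral_compProd]
  · congr 1
    ext z
    simp only
    rw [integral_const_mul, integral_indicator (measurableSet_singleton a)]
    simp [Measure.real]
  · refine Integrable.of_bound hG.aestronglyMeasurable C (Filter.Eventually.of_forall fun p => ?_)
    have := hC p.1
    have h0 := abs_nonneg (F p.1)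
    by_cases hp : p.2 = a <;> simp [Set.indicator, hp] <;> linarith

/-- **Theorem 1 (SF-PATE).** If the model `M` is `α`-fair w.r.t. `(X, A', Y)` and the
conditional distributions of `A` and `A'` given `(X, Y)` differ by at most `η`, then `M` is
`α'`-fair w.r.t. `(X, A, Y)` with
`α' = η·B / (min_a min {P(A' = a), P(A = a)}) + α`. -/
theorem sf_pate_fairness_transfer
    {Ω 𝒳 𝒴 : Type*} [MeasurableSpace Ω] [MeasurableSpace 𝒳] [MeasurableSpace 𝒴]
    (μ : Measure Ω) [IsProbabilityMeasure μ]
    {m : ℕ} [NeZero m]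
    (X : Ω → 𝒳) (Y : Ω → 𝒴) (A A' : Ω → Fin m)
    (hX : Measurable X) (hY : Measurable Y) (hA : Measurable A) (hA2 : Measurable A')
    (M : 𝒳 → 𝒴) (hM : Measurable M)
    (h : 𝒴 → 𝒴 → ℝ) (hh : Measurable fun p : 𝒴 × 𝒴 => h p.1 p.2)
    (B : ℝ) (hB : ∀ y y' : 𝒴, 0 ≤ h y y' ∧ h y y' ≤ B)
    (α η : ℝ) (hη : 0 < η)
    -- P(A = a) > 0 and P(A' = a) > 0 for every a
    (hposA : ∀ a : Fin m, 0 < μ (A ⁻¹' {a}))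
    (hposA' : ∀ a : Fin m, 0 < μ (A' ⁻¹' {a}))
    -- M is α-fair w.r.t. (X, A', Y) and h
    (hfair : ∀ a : Fin m, 0 < μ (A' ⁻¹' {a}) →
      |(∫ ω, h (M (X ω)) (Y ω) ∂(μ[|A' ⁻¹' {a}])) - ∫ ω, h (M (X ω)) (Y ω) ∂μ| ≤ α)
    -- the regular conditional distributions of A' and A given (X, Y) are η-close,
    -- almost everywhere under the law of (X, Y)
    (hclose : ∀ a : Fin m,
      ∀ᵐ p ∂(μ.map fun ω => (X ω, Y ω)),
        |(condDistrib A' (fun ω => (X ω, Y ω)) μ p {a}).toReal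
          - (condDistrib A (fun ω => (X ω, Y ω)) μ p {a}).toReal| ≤ η) :
    -- M is α'-fair w.r.t. (X, A, Y) and h
    ∀ a : Fin m, 0 < μ (A ⁻¹' {a}) →
      |(∫ ω, h (M (X ω)) (Y ω) ∂(μ[|A ⁻¹' {a}])) - ∫ ω, h (M (X ω)) (Y ω) ∂μ|
        ≤ η * B / (⨅ a : Fin m, min ((μ (A' ⁻¹' {a})).toReal) ((μ (A ⁻¹' {a})).toReal)) + α := by
  intro a ha
  set Z : Ω → 𝒳 × 𝒴 := fun ω => (X ω, Y ω) with hZdef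
  have hZ : Measurable Z := hX.prodMk hY
  have : IsProbabilityMeasure (μ.map Z) := Measure.isProbabilityMeasure_map hZ.aemeasurable
  let F : 𝒳 × 𝒴 → ℝ := fun p => h (M p.1) p.2
  have hF : Measurable F := hh.comp ((hM.comp measurable_fst).prodMk measurable_snd)
  have hFb : ∀ z, |F z| ≤ B := fun z => by
    rw [abs_of_nonneg (hB _ _).1]; exact (hB _ _).2
  have hcond : ∀ T : Ω → Fin m, (∫ ω, h (M (X ω)) (Y ω) ∂(μ[|T ⁻¹' {a}]))
      = (μ (T ⁻¹' {a})).toReal⁻¹ * ∫ ω in T ⁻¹' {a}, F (Z ω) ∂μ := by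
    intro T
    rw [ProbabilityTheory.cond, integral_smul_measure, ENNReal.toReal_inv, smul_eq_mul]
  have hFint : Integrable (fun ω => F (Z ω)) μ :=
    Integrable.of_bound (hF.comp hZ).aestronglyMeasurable B
      (Filter.Eventually.of_forall fun ω => hFb _)
  set p := (μ (A ⁻¹' {a})).toReal with hp
  set q := (μ (A' ⁻¹' {a})).toReal with hq
  have hp0 : 0 < p := ENNReal.toReal_pos (hposA a).ne' (measure_ne_top _ _)
  have hq0 : 0 < q := ENNReal.toReal_pos (hposA' a).ne' (measure_ne_top _ _)
  have hB0 : 0 ≤ B := by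
    obtain ⟨ω⟩ : Nonempty Ω := nonempty_of_isProbabilityMeasure μ
    exact (hB (Y ω) (Y ω)).1.trans (hB _ _).2
  have hf := hfair a (hposA' a)
  rw [hcond] at hf ⊢
  rw [← hq] at hf
  set c := q⁻¹ * ∫ ω in A' ⁻¹' {a}, F (Z ω) ∂μ with hc
  have hv0 : 0 ≤ ∫ ω in A' ⁻¹' {a}, F (Z ω) ∂μ := integral_nonneg fun ω => (hB _ _).1
  have hv1 : ∫ ω in A' ⁻¹' {a}, F (Z ω) ∂μ ≤ q * B := by
    have := integral_mono (μ := μ.restrict (A' ⁻¹' {a})) hFint.integrableOn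
      (integrable_const B) (fun ω => (hB (M (X ω)) (Y ω)).2)
    simpa [Measure.real, hq] using this
  have hc0 : 0 ≤ c := by positivity
  have hcB : c ≤ B := by
    rw [hc, inv_mul_le_iff₀ hq0]; exact hv1
  have hFc : ∀ z, |F z - c| ≤ B := fun z => by
    have h1 := (hB (M z.1) z.2).1
    have h2 := (hB (M z.1) z.2).2
    rw [abs_le]; constructor <;> simp only [F] <;> linarith
  have hFcm : Measurable (fun z => F z - c) := hF.sub_const c
  have k1 := setIntegral_eq_condDistrib_aux μ Z A hZ hA _ hFcm B hFc a
  have k2 := setIntegral_eq_condDistrib_aux μ Z A' hZ hA2 _ hFcm B hFc a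
  have hsub : ∀ T : Ω → Fin m, ∫ ω in T ⁻¹' {a}, (F (Z ω) - c) ∂μ
      = (∫ ω in T ⁻¹' {a}, F (Z ω) ∂μ) - (μ (T ⁻¹' {a})).toReal * c := by
    intro T
    rw [integral_sub hFint.integrableOn (integrable_const c)]
    simp [Measure.real]
  rw [hsub] at k1 k2
  have hz : (∫ ω in A' ⁻¹' {a}, F (Z ω) ∂μ) - q * c = 0 := by
    rw [hc]; field_simp; ring
  rw [← hq, hz] at k2
  have hint : ∀ T : Ω → Fin m, Integrable
      (fun z => (F z - c) * (condDistrib T Z μ z {a}).toReal) (μ.map Z) := by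
    intro T
    refine Integrable.of_bound (hFcm.mul
      (Kernel.measurable_coe _ (measurableSet_singleton a)).ennreal_toReal).aestronglyMeasurable B
      (Filter.Eventually.of_forall fun z => ?_)
    rw [norm_mul, Real.norm_eq_abs, Real.norm_eq_abs, abs_of_nonneg ENNReal.toReal_nonneg]
    have h1 : (condDistrib T Z μ z {a}).toReal ≤ 1 := measureReal_le_one
    calc |F z - c| * _ ≤ B * 1 := mul_le_mul (hFc z) h1 ENNReal.toReal_nonneg hB0
      _ = B := mul_one B
  have key : |(∫ ω in A ⁻¹' {a}, F (Z ω) ∂μ) - p * c| ≤ η * B := by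
    have e : (∫ ω in A ⁻¹' {a}, F (Z ω) ∂μ) - p * c
        = ∫ z, ((F z - c) * (condDistrib A Z μ z {a}).toReal
            - (F z - c) * (condDistrib A' Z μ z {a}).toReal) ∂(μ.map Z) := by
      rw [integral_sub (hint A) (hint A'), ← k2, ← k1, sub_zero]
    rw [e, ← Real.norm_eq_abs]
    have := norm_integral_le_of_norm_le_const (μ := μ.map Z) (C := η * B)
      (f := fun z => (F z - c) * (condDistrib A Z μ z {a}).toReal
            - (F z - c) * (condDistrib A' Z μ z {a}).toReal) (by
        filter_upwards [hclose a] with z hz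
        rw [← mul_sub, norm_mul, Real.norm_eq_abs, Real.norm_eq_abs, mul_comm, abs_sub_comm]
        exact mul_le_mul hz (hFc z) (abs_nonneg _) hη.le)
    simpa using this
  have hmin : (⨅ a : Fin m, min ((μ (A' ⁻¹' {a})).toReal) ((μ (A ⁻¹' {a})).toReal)) ≤ p :=
    (ciInf_le (Set.finite_range _).bddBelow a).trans (min_le_right _ _)
  have hmin0 : 0 < ⨅ a : Fin m, min ((μ (A' ⁻¹' {a})).toReal) ((μ (A ⁻¹' {a})).toReal) := by
    obtain ⟨b, hb⟩ := exists_eq_ciInf_of_finite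
      (f := fun a : Fin m => min ((μ (A' ⁻¹' {a})).toReal) ((μ (A ⁻¹' {a})).toReal))
    rw [← hb]
    exact lt_min (ENNReal.toReal_pos (hposA' b).ne' (measure_ne_top _ _))
      (ENNReal.toReal_pos (hposA b).ne' (measure_ne_top _ _))
  have hd : |p⁻¹ * (∫ ω in A ⁻¹' {a}, F (Z ω) ∂μ) - c| ≤ η * B /
      (⨅ a : Fin m, min ((μ (A' ⁻¹' {a})).toReal) ((μ (A ⁻¹' {a})).toReal)) := by
    have e : p⁻¹ * (∫ ω in A ⁻¹' {a}, F (Z ω) ∂μ) - c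
        = ((∫ ω in A ⁻¹' {a}, F (Z ω) ∂μ) - p * c) / p := by field_simp
    rw [e, abs_div, abs_of_pos hp0]
    exact div_le_div₀ (by positivity) key hmin0 hmin
  exact (abs_sub_le _ c _).trans (add_le_add hd hf)
end

section
/- Let (Ω, μ) be a probability space carrying random variables X : Ω → 𝒳, Y : Ω → 𝒴 and A, Ã : Ω → Fin m, let M : 𝒳 → 𝒴 be a measurable classifier and h : 𝒴 × 𝒴 → ℝ a measurable fairness function with 0 ≤ h(y, y') ≤ B. Suppose M is α-fair w.r.t. (X, Ã, Y) and h, that for every a ∈ Fin m and almost every (x, y) under the law of (X, Y) one has |P(Ã = a | X = x, Y = y) − P(A = a | X = x, Y = y)| ≤ η for some η > 0, and additionally that P(A = a) > η for every a ∈ Fin m. Then M is α'-fair w.r.t. (X, A, Y) and h with α' = η·B / (min_{a ∈ Fin m} P(A = a) − η) + α. -/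
open MeasureTheory ProbabilityTheory

lemma aux_setIntegral {Ω Z : Type*} [MeasurableSpace Ω] [MeasurableSpace Z]
    (μ : Measure Ω) [IsProbabilityMeasure μ] {m : ℕ} [NeZero m]
    (W : Ω → Z) (A : Ω → Fin m) (hW : Measurable W) (hA : Measurable A)
    (φ : Z → ℝ) (hφ : Measurable φ) (C : ℝ) (hC : ∀ z, |φ z| ≤ C) (a : Fin m) :
    ∫ ω in A ⁻¹' {a}, φ (W ω) ∂μ
      = ∫ z, φ z * (condDistrib A W μ z {a}).toReal ∂(μ.map W) := by
  have : IsProbabilityMeasure (μ.map W) := Measure.isProbabilityMeasure_map hW.aemeasurable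
  set F : Z × Fin m → ℝ := fun p => φ p.1 * ({a} : Set (Fin m)).indicator (fun _ => (1:ℝ)) p.2
    with hF
  have hFm : Measurable F := by
    refine (hφ.comp measurable_fst).mul ?_
    exact (measurable_const.indicator (measurableSet_singleton a)).comp measurable_snd
  have hmap : (μ.map W) ⊗ₘ (condDistrib A W μ) = μ.map (fun ω => (W ω, A ω)) :=
    compProd_map_condDistrib hA.aemeasurable
  have h1 : ∫ p, F p ∂(μ.map (fun ω => (W ω, A ω))) = ∫ ω in A ⁻¹' {a}, φ (W ω) ∂μ := by
    rw [integral_map (hW.prodMk hA).aemeasurable hFm.aestronglyMeasurable,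
      ← integral_indicator (hA (measurableSet_singleton a))]
    refine integral_congr_ae (Filter.Eventually.of_forall fun ω => ?_)
    by_cases hω : A ω = a <;> simp [hF, Set.indicator, hω]
  rw [← h1, ← hmap, Measure.integral_compProd]
  · refine integral_congr_ae (Filter.Eventually.of_forall fun z => ?_)
    simp only [hF]
    rw [integral_const_mul, integral_indicator (measurableSet_singleton a)]
    simp [Measure.real]
  · refine Integrable.of_bound hFm.aestronglyMeasurable C (Filter.Eventually.of_forall fun p => ?_)
    have := hC p.1
    have h0 := (abs_nonneg _).trans this
    by_cases hp : p.2 = a <;> simp [hF, Set.indicator, hp, this, h0]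

lemma aux_close {Ω Z : Type*} [MeasurableSpace Ω] [MeasurableSpace Z]
    (μ : Measure Ω) [IsProbabilityMeasure μ] {m : ℕ} [NeZero m]
    (W : Ω → Z) (A A' : Ω → Fin m) (hW : Measurable W) (hA : Measurable A) (hA' : Measurable A')
    (φ : Z → ℝ) (hφ : Measurable φ) (C : ℝ) (hC : ∀ z, |φ z| ≤ C) (a : Fin m) (η : ℝ)
    (hclose : ∀ᵐ p ∂(μ.map W),
        |(condDistrib A' W μ p {a}).toReal - (condDistrib A W μ p {a}).toReal| ≤ η) :
    |∫ ω in A' ⁻¹' {a}, φ (W ω) ∂μ - ∫ ω in A ⁻¹' {a}, φ (W ω) ∂μ| ≤ η * C := by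
  have : IsProbabilityMeasure (μ.map W) := Measure.isProbabilityMeasure_map hW.aemeasurable
  have hint : ∀ D : Ω → Fin m,
      Integrable (fun z => φ z * (condDistrib D W μ z {a}).toReal) (μ.map W) := by
    intro D
    refine Integrable.of_bound (hφ.mul
      ((Kernel.measurable_coe _ (measurableSet_singleton a)).ennreal_toReal)).aestronglyMeasurable
      C (Filter.Eventually.of_forall fun z => ?_)
    have h1 : (condDistrib D W μ z {a}).toReal ≤ 1 := measureReal_le_one
    have h2 : 0 ≤ (condDistrib D W μ z {a}).toReal := ENNReal.toReal_nonneg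
    rw [Real.norm_eq_abs, abs_mul, abs_of_nonneg h2]
    nlinarith [hC z, abs_nonneg (φ z)]
  rw [aux_setIntegral μ W A hW hA φ hφ C hC a, aux_setIntegral μ W A' hW hA' φ hφ C hC a,
    ← integral_sub (hint A') (hint A)]
  have := norm_integral_le_of_norm_le_const (μ := μ.map W) (C := η * C)
    (f := fun z => φ z * (condDistrib A' W μ z {a}).toReal
      - φ z * (condDistrib A W μ z {a}).toReal) (by
      filter_upwards [hclose] with z hz
      rw [← mul_sub, Real.norm_eq_abs, abs_mul, mul_comm]
      exact mul_le_mul hz (hC z) (abs_nonneg _) ((abs_nonneg _).trans hz))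
  simpa using this

/-- **Theorem 1, second part (SF-PATE).** If the model `M` is `α`-fair w.r.t. `(X, A', Y)`,
the conditional distributions of `A` and `A'` given `(X, Y)` differ by at most `η`, and
`P(A = a) > η` for every group `a`, then `M` is `α'`-fair w.r.t. `(X, A, Y)` with
`α' = η·B / (min_a P(A = a) − η) + α`. -/
theorem sf_pate_fairness_transfer_min
    {Ω 𝒳 𝒴 : Type*} [MeasurableSpace Ω] [MeasurableSpace 𝒳] [MeasurableSpace 𝒴]
    (μ : Measure Ω) [IsProbabilityMeasure μ]
    {m : ℕ} [NeZero m]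
    (X : Ω → 𝒳) (Y : Ω → 𝒴) (A A' : Ω → Fin m)
    (hX : Measurable X) (hY : Measurable Y) (hA : Measurable A) (hA2 : Measurable A')
    (M : 𝒳 → 𝒴) (hM : Measurable M)
    (h : 𝒴 → 𝒴 → ℝ) (hh : Measurable fun p : 𝒴 × 𝒴 => h p.1 p.2)
    (B : ℝ) (hB : ∀ y y' : 𝒴, 0 ≤ h y y' ∧ h y y' ≤ B)
    (α η : ℝ) (hη : 0 < η)
    -- M is α-fair w.r.t. (X, A', Y) and h
    (hfair : ∀ a : Fin m, 0 < μ (A' ⁻¹' {a}) →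
      |(∫ ω, h (M (X ω)) (Y ω) ∂(μ[|A' ⁻¹' {a}])) - ∫ ω, h (M (X ω)) (Y ω) ∂μ| ≤ α)
    -- the regular conditional distributions of A' and A given (X, Y) are η-close,
    -- almost everywhere under the law of (X, Y)
    (hclose : ∀ a : Fin m,
      ∀ᵐ p ∂(μ.map fun ω => (X ω, Y ω)),
        |(condDistrib A' (fun ω => (X ω, Y ω)) μ p {a}).toReal
          - (condDistrib A (fun ω => (X ω, Y ω)) μ p {a}).toReal| ≤ η)
    -- P(A = a) > η for every a
    (hposA : ∀ a : Fin m, η < (μ (A ⁻¹' {a})).toReal) :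
    -- M is α'-fair w.r.t. (X, A, Y) and h
    ∀ a : Fin m, 0 < μ (A ⁻¹' {a}) →
      |(∫ ω, h (M (X ω)) (Y ω) ∂(μ[|A ⁻¹' {a}])) - ∫ ω, h (M (X ω)) (Y ω) ∂μ|
        ≤ η * B / ((⨅ a : Fin m, (μ (A ⁻¹' {a})).toReal) - η) + α := by
  intro a ha
  have hW : Measurable fun ω => (X ω, Y ω) := hX.prodMk hY
  set f : 𝒳 × 𝒴 → ℝ := fun p => h (M p.1) p.2 with hf
  have hfm : Measurable f := hh.comp ((hM.comp measurable_fst).prodMk measurable_snd)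
  have hf0 : ∀ z, 0 ≤ f z := fun z => (hB _ _).1
  have hfB : ∀ z, f z ≤ B := fun z => (hB _ _).2
  have hfint : ∀ ν : Measure Ω, IsFiniteMeasure ν → Integrable (fun ω => f (X ω, Y ω)) ν := by
    intro ν _
    refine Integrable.of_bound (hfm.comp hW).aestronglyMeasurable B
      (Filter.Eventually.of_forall fun ω => ?_)
    rw [Real.norm_eq_abs, abs_of_nonneg (hf0 _)]
    exact hfB _
  have hcond : ∀ D : Ω → Fin m, ∫ ω, h (M (X ω)) (Y ω) ∂(μ[|D ⁻¹' {a}])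
      = (μ (D ⁻¹' {a})).toReal⁻¹ * ∫ ω in D ⁻¹' {a}, f (X ω, Y ω) ∂μ := by
    intro D
    rw [ProbabilityTheory.cond, integral_smul_measure]
    simp [hf]
  set p := (μ (A ⁻¹' {a})).toReal with hp
  set q := (μ (A' ⁻¹' {a})).toReal with hq
  have hpη : η < p := hposA a
  have hp0 : 0 < p := hη.trans hpη
  have hpq : |q - p| ≤ η := by
    have := aux_close μ _ A A' hW hA hA2 (fun _ => 1) measurable_const 1 (by simp) a η (hclose a)
    simpa [Measure.real] using this
  have hqp : p - η ≤ q := by linarith [(abs_le.1 hpq).1]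
  have hq0 : 0 < q := by linarith
  set S := ∫ ω in A ⁻¹' {a}, f (X ω, Y ω) ∂μ with hS
  set T := ∫ ω in A' ⁻¹' {a}, f (X ω, Y ω) ∂μ with hT
  have hS0 : 0 ≤ S := integral_nonneg fun ω => hf0 _
  have hSB : S ≤ B * p := by
    have : S ≤ ∫ ω in A ⁻¹' {a}, B ∂μ :=
      integral_mono (hfint _ inferInstance) (integrable_const _) fun ω => hfB _
    simpa [Measure.real, mul_comm] using this
  set c := p⁻¹ * S with hc
  have hc0 : 0 ≤ c := by positivity
  have hcp : c * p = S := by rw [hc]; field_simp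
  have hcB : c ≤ B := by
    by_contra hcon
    push Not at hcon
    nlinarith
  have hB0 : 0 ≤ B := hc0.trans hcB
  have key : |T - c * q| ≤ η * B := by
    have := aux_close μ _ A A' hW hA hA2 (fun z => f z - c) (hfm.sub measurable_const) B
      (fun z => abs_le.2 ⟨by linarith [hf0 z], by linarith [hfB z]⟩) a η (hclose a)
    rw [integral_sub (hfint _ inferInstance) (integrable_const _),
      integral_sub (hfint _ inferInstance) (integrable_const _)] at this
    simp only [integral_const, smul_eq_mul, Measure.real, Measure.restrict_apply_univ] at this
    rw [← hS, ← hT, ← hp, ← hq] at this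
    have e : T - q * c - (S - p * c) = T - c * q := by rw [← hcp]; ring
    rwa [e] at this
  have hI : ∀ b, (⨅ a : Fin m, (μ (A ⁻¹' {a})).toReal) ≤ (μ (A ⁻¹' {b})).toReal :=
    fun b => ciInf_le (Set.finite_range _).bddBelow b
  have hIη : η < ⨅ a : Fin m, (μ (A ⁻¹' {a})).toReal := by
    obtain ⟨b, hb⟩ := exists_eq_ciInf_of_finite (f := fun a : Fin m => (μ (A ⁻¹' {a})).toReal)
    rw [← hb]; exact hposA b
  have hIa := hI a
  rw [← hp] at hIa
  have hF := hfair a (ENNReal.toReal_pos_iff.1 hq0).1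
  rw [hcond] at hF
  rw [hcond, ← hp, ← hS, ← hc]
  rw [← hq, ← hT] at hF
  have hcT : |c - q⁻¹ * T| ≤ η * B / ((⨅ a : Fin m, (μ (A ⁻¹' {a})).toReal) - η) := by
    have e : c - q⁻¹ * T = -(T - c * q) / q := by field_simp; ring
    rw [e, abs_div, abs_neg, abs_of_pos hq0]
    exact div_le_div₀ (by positivity) key (by linarith) (by linarith)
  exact (abs_sub_le _ (q⁻¹ * T) _).trans (add_le_add hcT hF)
end

section
/- Let m ≥ 2, ε ≥ 0, and let (Ω, μ) be a probability space carrying random variables X : Ω → 𝒳, Y : Ω → 𝒴 and A, Ã : Ω → Fin m. Suppose Ã is produced from A by the randomized response mechanism with parameter ε, conditionally independently of (X, Y) given A: for all a, a' ∈ Fin m and every measurable set S of (X, Y)-values, P(Ã = a' ∧ A = a ∧ (X, Y) ∈ S) = k(a, a') · P(A = a ∧ (X, Y) ∈ S), where k(a, a) = exp(ε)/(exp(ε) + m − 1) and k(a, a') = 1/(exp(ε) + m − 1) for a' ≠ a. Let M : 𝒳 → 𝒴 be a measurable classifier and h : 𝒴 × 𝒴 → ℝ a measurable fairness function with 0 ≤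 h ≤ B, and suppose P(A = a) > 0 and P(Ã = a) > 0 for all a and that M is α-fair w.r.t. (X, Ã, Y) and h. Then M is α'-fair w.r.t. (X, A, Y) and h with α' = η·B / (min_{a ∈ Fin m} min{P(Ã = a), P(A = a)}) + α, where η = (m − 1)/(exp(ε) + m − 1). -/
open MeasureTheory ProbabilityTheory

lemma rr_split {Ω : Type*} [MeasurableSpace Ω] (μ : Measure Ω)
    (m : ℕ) (A : Ω → Fin m) (hA : Measurable A) (s : Set Ω) (hs : MeasurableSet s)
    (f : Ω → ℝ) (hf : Integrable f μ) :
    ∫ ω in s, f ω ∂μ = ∑ b : Fin m, ∫ ω in s ∩ A ⁻¹' {b}, f ω ∂μ := by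
  have hU : s = ⋃ b : Fin m, s ∩ A ⁻¹' {b} := by
    ext ω; simp
  conv_lhs => rw [hU]
  apply integral_iUnion_fintype
  · intro b
    exact hs.inter (hA (measurableSet_singleton b))
  · intro b c hbc
    refine Set.disjoint_left.2 ?_
    rintro ω ⟨_, h1⟩ ⟨_, h2⟩
    simp only [Set.mem_preimage, Set.mem_singleton_iff] at h1 h2
    exact hbc (h1.symm.trans h2)
  · intro b
    exact hf.integrableOn

lemma rr_cell {Ω 𝒵 : Type*} [MeasurableSpace Ω] [MeasurableSpace 𝒵]
    (μ : Measure Ω) [IsFiniteMeasure μ] (Z : Ω → 𝒵) (hZ : Measurable Z)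
    (s t : Set Ω) (k : ℝ) (hk : 0 ≤ k)
    (hst : ∀ S : Set 𝒵, MeasurableSet S →
      (μ (Z ⁻¹' S ∩ s)).toReal = k * (μ (Z ⁻¹' S ∩ t)).toReal)
    (g : 𝒵 → ℝ) (hg : Measurable g) :
    ∫ ω in s, g (Z ω) ∂μ = k * ∫ ω in t, g (Z ω) ∂μ := by
  have hmap : (μ.restrict s).map Z = ENNReal.ofReal k • (μ.restrict t).map Z := by
    ext S hS
    rw [Measure.smul_apply, Measure.map_apply hZ hS, Measure.map_apply hZ hS,
      Measure.restrict_apply (hZ hS), Measure.restrict_apply (hZ hS), smul_eq_mul]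
    rw [← ENNReal.toReal_eq_toReal_iff' (measure_ne_top _ _)
      (ENNReal.mul_ne_top ENNReal.ofReal_ne_top (measure_ne_top _ _)),
      ENNReal.toReal_mul, ENNReal.toReal_ofReal hk]
    exact hst S hS
  rw [← integral_map hZ.aemeasurable hg.aestronglyMeasurable,
    ← integral_map hZ.aemeasurable hg.aestronglyMeasurable, hmap, integral_smul_measure,
    ENNReal.toReal_ofReal hk, smul_eq_mul]

lemma rr_real (p q E F T B d η κ N α : ℝ) (hp : 0 < p) (hq : 0 < q) (hN : 0 < N)
    (hNq : N ≤ q) (hd : 0 ≤ d) (hdη : d ≤ η) (hp1 : p ≤ 1) (hE0 : 0 ≤ E) (hE : E ≤ B * p)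
    (hT0 : 0 ≤ T - E) (hT : T - E ≤ B * (1 - p)) (hB : 0 ≤ B)
    (hF : F = κ * E + d * (T - E)) (hqe : q = κ * p + d * (1 - p))
    (hfair : |q⁻¹ * F - T| ≤ α) : |p⁻¹ * E - T| ≤ η * B / N + α := by
  have hdiff : p⁻¹ * E - q⁻¹ * F = d * (E * (1 - p) - (T - E) * p) / (p * q) := by
    have : p⁻¹ * E - q⁻¹ * F = (E * q - F * p) / (p * q) := by
      field_simp
    rw [this, hF]
    congr 1
    rw [hqe]; ring
  have habs : |E * (1 - p) - (T - E) * p| ≤ B * p := by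
    rw [abs_le]
    constructor <;> nlinarith [mul_nonneg hE0 hp.le, mul_nonneg hT0 hp.le,
      mul_nonneg hE0 (sub_nonneg.2 hp1), mul_le_mul_of_nonneg_right hT hp.le,
      mul_nonneg hB (mul_nonneg hp.le hp.le)]
  have h1 : |p⁻¹ * E - q⁻¹ * F| ≤ η * B / N := by
    rw [hdiff, abs_div, abs_mul, abs_of_nonneg hd, abs_of_pos (mul_pos hp hq)]
    calc d * |E * (1 - p) - (T - E) * p| / (p * q) ≤ d * (B * p) / (p * q) := by gcongr
      _ = d * B / q := by field_simp
      _ ≤ η * B / N := by gcongr; exact mul_nonneg (hd.trans hdη) hB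
  calc |p⁻¹ * E - T| = |(p⁻¹ * E - q⁻¹ * F) + (q⁻¹ * F - T)| := by congr 1; ring
    _ ≤ _ := (abs_add_le _ _).trans (add_le_add h1 hfair)

/-- **Corollary 1 (SF-PATE).** If `A'` is obtained from `A` by the randomized response
mechanism with parameter `ε` (conditionally independently of `(X, Y)` given `A`) and the
model `M` is `α`-fair w.r.t. `(X, A', Y)`, then `M` is `α'`-fair w.r.t. `(X, A, Y)` with
`α' = η·B / (min_a min {P(A' = a), P(A = a)}) + α` where `η = (m − 1)/(exp ε + m − 1)`. -/
theorem randomized_response_fairness_transfer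
    {Ω 𝒳 𝒴 : Type*} [MeasurableSpace Ω] [MeasurableSpace 𝒳] [MeasurableSpace 𝒴]
    (μ : Measure Ω) [IsProbabilityMeasure μ]
    (m : ℕ) (hm : 2 ≤ m) (ε : ℝ) (hε : 0 ≤ ε)
    (X : Ω → 𝒳) (Y : Ω → 𝒴) (A A' : Ω → Fin m)
    (hX : Measurable X) (hY : Measurable Y) (hA : Measurable A) (hA2 : Measurable A')
    -- A' is the randomized response of A, conditionally independent of (X, Y) given A
    (hrr : ∀ a a' : Fin m, ∀ S : Set (𝒳 × 𝒴), MeasurableSet S →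
      (μ {ω | A' ω = a' ∧ A ω = a ∧ (X ω, Y ω) ∈ S}).toReal
        = (if a' = a then Real.exp ε / (Real.exp ε + m - 1)
            else 1 / (Real.exp ε + m - 1))
          * (μ {ω | A ω = a ∧ (X ω, Y ω) ∈ S}).toReal)
    (M : 𝒳 → 𝒴) (hM : Measurable M)
    (h : 𝒴 → 𝒴 → ℝ) (hh : Measurable fun p : 𝒴 × 𝒴 => h p.1 p.2)
    (B : ℝ) (hB : ∀ y y' : 𝒴, 0 ≤ h y y' ∧ h y y' ≤ B)
    (α : ℝ)
    -- P(A = a) > 0 and P(A' = a) > 0 for every a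
    (hposA : ∀ a : Fin m, 0 < μ (A ⁻¹' {a}))
    (hposA' : ∀ a : Fin m, 0 < μ (A' ⁻¹' {a}))
    -- M is α-fair w.r.t. (X, A', Y) and h
    (hfair : ∀ a : Fin m, 0 < μ (A' ⁻¹' {a}) →
      |(∫ ω, h (M (X ω)) (Y ω) ∂(μ[|A' ⁻¹' {a}])) - ∫ ω, h (M (X ω)) (Y ω) ∂μ| ≤ α) :
    -- M is α'-fair w.r.t. (X, A, Y) and h, with η = (m − 1)/(exp ε + m − 1)
    ∀ a : Fin m, 0 < μ (A ⁻¹' {a}) →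
      |(∫ ω, h (M (X ω)) (Y ω) ∂(μ[|A ⁻¹' {a}])) - ∫ ω, h (M (X ω)) (Y ω) ∂μ|
        ≤ ((m - 1) / (Real.exp ε + m - 1)) * B
            / (⨅ a : Fin m, min ((μ (A' ⁻¹' {a})).toReal) ((μ (A ⁻¹' {a})).toReal)) + α := by
  intro a _
  have hm' : (2 : ℝ) ≤ m := by exact_mod_cast hm
  have hexp := Real.exp_pos ε
  have hD : 0 < Real.exp ε + m - 1 := by linarith
  set D := Real.exp ε + m - 1 with hDdef
  have hZ : Measurable fun ω => (X ω, Y ω) := hX.prodMk hY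
  have hmA : ∀ b, MeasurableSet (A ⁻¹' {b}) := fun b => hA (measurableSet_singleton b)
  have hmA' : ∀ b, MeasurableSet (A' ⁻¹' {b}) := fun b => hA2 (measurableSet_singleton b)
  have hcell : ∀ b, ∀ g : 𝒳 × 𝒴 → ℝ, Measurable g →
      ∫ ω in A' ⁻¹' {a} ∩ A ⁻¹' {b}, g (X ω, Y ω) ∂μ
        = (if a = b then Real.exp ε / D else 1 / D) * ∫ ω in A ⁻¹' {b}, g (X ω, Y ω) ∂μ := by
    intro b g hg
    refine rr_cell μ (fun ω => (X ω, Y ω)) hZ _ _ _ (by split_ifs <;> positivity) ?_ g hg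
    intro S hS
    have := hrr b a S hS
    convert this using 4
    · ext ω; simp; tauto
    · ext ω; simp; tauto
  have hkey : ∀ g : 𝒳 × 𝒴 → ℝ, Measurable g → Integrable (fun ω => g (X ω, Y ω)) μ →
      ∫ ω in A' ⁻¹' {a}, g (X ω, Y ω) ∂μ
        = Real.exp ε / D * ∫ ω in A ⁻¹' {a}, g (X ω, Y ω) ∂μ
          + 1 / D * (∫ ω, g (X ω, Y ω) ∂μ - ∫ ω in A ⁻¹' {a}, g (X ω, Y ω) ∂μ) := by
    intro g hg hgi
    have hT := rr_split μ m A hA Set.univ MeasurableSet.univ _ hgi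
    rw [rr_split μ m A hA _ (hmA' a) _ hgi]
    simp only [Set.univ_inter, Measure.restrict_univ] at hT
    rw [hT, Finset.sum_congr rfl (fun b _ => hcell b g hg),
      ← Finset.add_sum_erase _ _ (Finset.mem_univ a),
      ← Finset.add_sum_erase Finset.univ (fun b => ∫ ω in A ⁻¹' {b}, g (X ω, Y ω) ∂μ)
        (Finset.mem_univ a), if_pos rfl, add_sub_cancel_left, Finset.mul_sum]
    congr 1
    refine Finset.sum_congr rfl fun b hb => ?_
    rw [if_neg (Finset.ne_of_mem_erase hb).symm]
  have hfm : Measurable fun z : 𝒳 × 𝒴 => h (M z.1) z.2 :=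
    hh.comp ((hM.comp measurable_fst).prodMk measurable_snd)
  have hfi : Integrable (fun ω => h (M (X ω)) (Y ω)) μ := by
    refine Integrable.of_bound (hfm.comp hZ).aestronglyMeasurable B (ae_of_all _ fun ω => ?_)
    rw [Real.norm_eq_abs, abs_of_nonneg (hB _ _).1]
    exact (hB _ _).2
  have hF := hkey _ hfm hfi
  have hq := hkey (fun _ => 1) measurable_const (integrable_const _)
  simp only [integral_const, smul_eq_mul, mul_one, measureReal_restrict_apply_univ,
    probReal_univ] at hq
  have hcond : ∀ s : Set Ω, ∫ ω, h (M (X ω)) (Y ω) ∂(μ[|s])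
      = (μ.real s)⁻¹ * ∫ ω in s, h (M (X ω)) (Y ω) ∂μ := by
    intro s
    rw [ProbabilityTheory.cond, integral_smul_measure, ENNReal.toReal_inv, smul_eq_mul]
    rfl
  have hfa := hfair a (hposA' a)
  rw [hcond] at hfa ⊢
  have hpos : ∀ b, 0 < min ((μ (A' ⁻¹' {b})).toReal) ((μ (A ⁻¹' {b})).toReal) := fun b =>
    lt_min (ENNReal.toReal_pos (hposA' b).ne' (measure_ne_top _ _))
      (ENNReal.toReal_pos (hposA b).ne' (measure_ne_top _ _))
  haveI : Nonempty (Fin m) := ⟨a⟩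
  have hbound : ∀ s : Set Ω, MeasurableSet s → 0 ≤ ∫ ω in s, h (M (X ω)) (Y ω) ∂μ ∧
      ∫ ω in s, h (M (X ω)) (Y ω) ∂μ ≤ B * μ.real s := by
    intro s hs
    refine ⟨integral_nonneg fun ω => (hB _ _).1, ?_⟩
    calc ∫ ω in s, h (M (X ω)) (Y ω) ∂μ ≤ ∫ ω in s, B ∂μ :=
          integral_mono hfi.integrableOn (integrable_const _) fun ω => (hB _ _).2
      _ = B * μ.real s := by simp [mul_comm]
  have hcompl := integral_add_compl (hmA a) hfi
  have hpc := probReal_compl_eq_one_sub (μ := μ) (hmA a)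
  have hb1 := hbound _ (hmA a)
  have hb2 := hbound _ (hmA a).compl
  rw [hpc] at hb2
  have hTE : ∫ ω, h (M (X ω)) (Y ω) ∂μ - ∫ ω in A ⁻¹' {a}, h (M (X ω)) (Y ω) ∂μ
      = ∫ ω in (A ⁻¹' {a})ᶜ, h (M (X ω)) (Y ω) ∂μ := by linarith
  obtain ⟨ω₀⟩ : Nonempty Ω := nonempty_of_isProbabilityMeasure μ
  refine rr_real (μ.real (A ⁻¹' {a})) (μ.real (A' ⁻¹' {a})) _ _ _ B (1 / D) _ (Real.exp ε / D)
    _ α ((hpos a).trans_le (min_le_right _ _)) ((hpos a).trans_le (min_le_left _ _)) ?_ ?_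
    (by positivity) ?_ measureReal_le_one hb1.1 hb1.2 (hTE ▸ hb2.1) (hTE ▸ hb2.2)
    ((hB (Y ω₀) (Y ω₀)).1.trans (hB (Y ω₀) (Y ω₀)).2) hF hq hfa
  · obtain ⟨b, hb⟩ := exists_eq_ciInf_of_finite
      (f := fun b : Fin m => min ((μ (A' ⁻¹' {b})).toReal) ((μ (A ⁻¹' {b})).toReal))
    rw [← hb]
    exact hpos b
  · exact (ciInf_le (Set.finite_range _).bddBelow a).trans (min_le_left _ _)
  · gcongr
    linarith
end

section
/- Let γ > 1, σ > 0, δ ∈ (0, 1), and let s, d be natural numbers. For i ∈ Fin s let μᵢ, νᵢ : Fin d → ℝ be mean vectors with Σ_{a ∈ Fin d} (μᵢ a − νᵢ a)² ≤ 2 for every i, and let P = ⊗_{i ∈ Fin s} ⊗_{a ∈ Fin d} N(μᵢ a, σ²) and Q = ⊗_{i ∈ Fin s} ⊗_{a ∈ Fin d} N(νᵢ a, σ²) be the corresponding product Gaussian probability measures on (Fin s → Fin d → ℝ). Then for every measurable set S, P(S) ≤ exp(s·γ/σ² + log(1/δ)/(γ − 1)) · Q(S) + δ. Consequently, the SF-PATE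 algorithm, which answers s teacher-ensemble voting queries of ℓ₂-sensitivity √2 each perturbed with independent Gaussian noise N(0, σ²) per coordinate, satisfies (s·γ/σ² + log(1/δ)/(γ − 1), δ)-differential privacy. -/
open MeasureTheory ProbabilityTheory

open scoped NNReal ENNReal

lemma aux_lintegral_pi {n : ℕ} {X : Type*} [MeasurableSpace X] (Q : Fin n → Measure X)
    [∀ i, IsProbabilityMeasure (Q i)] (f : Fin n → X → ℝ≥0∞) (hf : ∀ i, Measurable (f i)) :
    ∫⁻ x, ∏ i, f i (x i) ∂(Measure.pi Q) = ∏ i, ∫⁻ x, f i x ∂(Q i) := by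
  have hind : iIndepFun (fun i (x : Fin n → X) => f i (x i)) (Measure.pi Q) :=
    iIndepFun_pi (fun i => (hf i).aemeasurable)
  have h := lintegral_prod_eq_prod_lintegral_of_indepFun (Finset.univ)
    (fun i (x : Fin n → X) => f i (x i)) hind
    (fun i => (hf i).comp (measurable_pi_apply i))
  rw [h]
  refine Finset.prod_congr rfl fun i _ => ?_
  exact (measurePreserving_eval Q i).lintegral_comp (hf i)

lemma aux_withDensity_pi {n : ℕ} {X : Type*} [MeasurableSpace X] (P Q : Fin n → Measure X)
    [∀ i, IsProbabilityMeasure (P i)]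
    [∀ i, IsProbabilityMeasure (Q i)] (f : Fin n → X → ℝ≥0∞) (hf : ∀ i, Measurable (f i))
    (h : ∀ i, P i = (Q i).withDensity (f i)) :
    Measure.pi P = (Measure.pi Q).withDensity (fun x => ∏ i, f i (x i)) := by
  refine Measure.pi_eq fun s hs => ?_
  rw [withDensity_apply _ (MeasurableSet.univ_pi hs),
    ← lintegral_indicator (MeasurableSet.univ_pi hs)]
  have : ∀ x : Fin n → X, (Set.univ.pi s).indicator (fun x => ∏ i, f i (x i)) x
      = ∏ i, (s i).indicator (f i) (x i) := by
    intro x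
    by_cases hx : x ∈ Set.univ.pi s
    · rw [Set.indicator_of_mem hx]
      refine Finset.prod_congr rfl fun i _ => ?_
      rw [Set.indicator_of_mem (hx i trivial)]
    · rw [Set.indicator_of_notMem hx]
      simp only [Set.mem_pi, Set.mem_univ, true_imp_iff, not_forall] at hx
      obtain ⟨i, hi⟩ := hx
      exact (Finset.prod_eq_zero (Finset.mem_univ i) (Set.indicator_of_notMem hi _)).symm
  simp_rw [this]
  rw [aux_lintegral_pi Q _ (fun i => (hf i).indicator (hs i))]
  refine Finset.prod_congr rfl fun i _ => ?_
  rw [lintegral_indicator (hs i), h i, withDensity_apply _ (hs i)]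

/-- `P` has density `f` with respect to `Q`, with bounded moment of order `γ`. -/
def AuxGood {X : Type*} [MeasurableSpace X] (γ : ℝ) (P Q : Measure X) (c : ℝ) : Prop :=
  ∃ f : X → ℝ≥0∞, Measurable f ∧ P = Q.withDensity f ∧
    ∫⁻ x, f x ^ γ ∂Q ≤ ENNReal.ofReal (Real.exp c)

lemma aux_good_pi {n : ℕ} {X : Type*} [MeasurableSpace X] {γ : ℝ} (hγ : 0 ≤ γ)
    (P Q : Fin n → Measure X)
    [∀ i, IsProbabilityMeasure (P i)] [∀ i, IsProbabilityMeasure (Q i)] (c : Fin n → ℝ)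
    (h : ∀ i, AuxGood γ (P i) (Q i) (c i)) :
    AuxGood γ (Measure.pi P) (Measure.pi Q) (∑ i, c i) := by
  choose f hf hd hm using h
  refine ⟨fun x => ∏ i, f i (x i), ?_, aux_withDensity_pi P Q f hf hd, ?_⟩
  · exact Finset.measurable_prod _ fun i _ => (hf i).comp (measurable_pi_apply i)
  · simp_rw [← ENNReal.prod_rpow_of_nonneg hγ]
    rw [aux_lintegral_pi Q (fun i x => f i x ^ γ) (fun i => (hf i).pow_const γ), Real.exp_sum,
      ENNReal.ofReal_prod_of_nonneg (fun i _ => (Real.exp_pos _).le)]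
    exact Finset.prod_le_prod' fun i _ => hm i

lemma aux_good_gaussian (γ m n : ℝ) (v : ℝ≥0) (hv : v ≠ 0) :
    AuxGood γ (gaussianReal m v) (gaussianReal n v) (γ * (γ - 1) * (m - n) ^ 2 / (2 * v)) := by
  have hv' : (v : ℝ) ≠ 0 := by exact_mod_cast hv
  let g : ℝ → ℝ := fun x => Real.exp (((x - n) ^ 2 - (x - m) ^ 2) / (2 * v))
  have hg : Measurable fun x => ENNReal.ofReal (g x) := by
    simp only [g]; fun_prop
  refine ⟨fun x => ENNReal.ofReal (g x), hg, ?_, ?_⟩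
  · rw [gaussianReal_of_var_ne_zero _ hv, gaussianReal_of_var_ne_zero _ hv,
      ← withDensity_mul _ (measurable_gaussianPDF n v) hg]
    congr 1
    ext x
    simp only [Pi.mul_apply, gaussianPDF, g]
    rw [← ENNReal.ofReal_mul (gaussianPDFReal_nonneg _ _ _)]
    congr 1
    simp only [gaussianPDFReal]
    rw [mul_assoc (√(2 * Real.pi * v))⁻¹, ← Real.exp_add]
    congr 2
    field_simp
    ring
  · rw [gaussianReal_of_var_ne_zero _ hv,
      lintegral_withDensity_eq_lintegral_mul _ (measurable_gaussianPDF n v) (hg.pow_const γ)]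
    have : ∀ x, (gaussianPDF n v * fun x => ENNReal.ofReal (g x) ^ γ) x
        = ENNReal.ofReal (Real.exp (γ * (γ - 1) * (m - n) ^ 2 / (2 * v))) *
          gaussianPDF (n + γ * (m - n)) v x := by
      intro x
      simp only [Pi.mul_apply, gaussianPDF, g]
      rw [ENNReal.ofReal_rpow_of_pos (Real.exp_pos _), ← Real.exp_mul,
        ← ENNReal.ofReal_mul (gaussianPDFReal_nonneg _ _ _),
        ← ENNReal.ofReal_mul (Real.exp_pos _).le]
      congr 1
      simp only [gaussianPDFReal]
      rw [mul_assoc (√(2 * Real.pi * v))⁻¹, ← Real.exp_add, mul_left_comm, ← Real.exp_add]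
      congr 2
      field_simp
      ring
    simp_rw [this]
    rw [lintegral_const_mul _ (measurable_gaussianPDF _ _), lintegral_gaussianPDF_eq_one _ hv,
      mul_one]

lemma aux_pointwise (γ ε : ℝ) (hγ : 1 < γ) (a : ℝ≥0∞) :
    a ≤ ENNReal.ofReal (Real.exp ε) + ENNReal.ofReal (Real.exp (-(ε * (γ - 1)))) * a ^ γ := by
  rcases le_total a (ENNReal.ofReal (Real.exp ε)) with h | h
  · exact h.trans le_self_add
  · refine le_trans ?_ le_add_self
    have h1 : a ^ γ = a * a ^ (γ - 1) := by
      conv_lhs => rw [show γ = 1 + (γ - 1) by ring]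
      rw [ENNReal.rpow_add_of_nonneg _ _ zero_le_one (by linarith), ENNReal.rpow_one]
    have h2 : ENNReal.ofReal (Real.exp (ε * (γ - 1))) ≤ a ^ (γ - 1) := by
      have := ENNReal.rpow_le_rpow h (show 0 ≤ γ - 1 by linarith)
      rwa [ENNReal.ofReal_rpow_of_pos (Real.exp_pos _), ← Real.exp_mul] at this
    calc a = a * (ENNReal.ofReal (Real.exp (-(ε * (γ - 1)))) *
              ENNReal.ofReal (Real.exp (ε * (γ - 1)))) := by
            rw [← ENNReal.ofReal_mul (Real.exp_pos _).le, ← Real.exp_add]; simp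
      _ ≤ a * (ENNReal.ofReal (Real.exp (-(ε * (γ - 1)))) * a ^ (γ - 1)) := by gcongr
      _ = _ := by rw [h1]; ring

lemma aux_good_dp {X : Type*} [MeasurableSpace X] (γ ε c : ℝ) (hγ : 1 < γ) (P Q : Measure X)
    [IsProbabilityMeasure P] [IsProbabilityMeasure Q] (h : AuxGood γ P Q c)
    (S : Set X) (hS : MeasurableSet S) :
    (P S).toReal ≤ Real.exp ε * (Q S).toReal + Real.exp (c - ε * (γ - 1)) := by
  obtain ⟨f, hf, rfl, hm⟩ := h
  have key : Q.withDensity f S ≤ ENNReal.ofReal (Real.exp ε) * Q S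
      + ENNReal.ofReal (Real.exp (c - ε * (γ - 1))) := by
    rw [withDensity_apply _ hS]
    calc ∫⁻ x in S, f x ∂Q ≤ ∫⁻ x in S, (ENNReal.ofReal (Real.exp ε)
            + ENNReal.ofReal (Real.exp (-(ε * (γ - 1)))) * f x ^ γ) ∂Q :=
          lintegral_mono fun x => aux_pointwise γ ε hγ (f x)
      _ = ENNReal.ofReal (Real.exp ε) * Q S
            + ENNReal.ofReal (Real.exp (-(ε * (γ - 1)))) * ∫⁻ x in S, f x ^ γ ∂Q := by
          rw [lintegral_add_left measurable_const, setLIntegral_const,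
            lintegral_const_mul _ (hf.pow_const γ)]
      _ ≤ ENNReal.ofReal (Real.exp ε) * Q S
            + ENNReal.ofReal (Real.exp (-(ε * (γ - 1)))) * ENNReal.ofReal (Real.exp c) := by
          gcongr
          exact (setLIntegral_le_lintegral _ _).trans hm
      _ = _ := by
          rw [← ENNReal.ofReal_mul (Real.exp_pos _).le, ← Real.exp_add]
          congr 3
          ring
  have h1 : ENNReal.ofReal (Real.exp ε) * Q S ≠ ∞ :=
    ENNReal.mul_ne_top ENNReal.ofReal_ne_top (measure_ne_top _ _)
  have := ENNReal.toReal_mono (ENNReal.add_ne_top.2 ⟨h1, ENNReal.ofReal_ne_top⟩) key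
  rwa [ENNReal.toReal_add h1 ENNReal.ofReal_ne_top, ENNReal.toReal_mul,
    ENNReal.toReal_ofReal (Real.exp_pos _).le, ENNReal.toReal_ofReal (Real.exp_pos _).le] at this

theorem aux_main
    (γ σ δ : ℝ) (hγ : 1 < γ) (hσ : 0 < σ) (hδ0 : 0 < δ) (hδ1 : δ < 1)
    (s d : ℕ) (μ ν : Fin s → Fin d → ℝ)
    (v : ℝ≥0) (hv2 : (v : ℝ) = σ ^ 2)
    (hsens : ∀ i : Fin s, ∑ a : Fin d, (μ i a - ν i a) ^ 2 ≤ 2) :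
    ∀ S : Set (Fin s → Fin d → ℝ), MeasurableSet S →
      ((Measure.pi fun i : Fin s =>
          Measure.pi fun a : Fin d => gaussianReal (μ i a) v) S).toReal
        ≤ Real.exp ((s : ℝ) * γ / σ ^ 2 + Real.log (1 / δ) / (γ - 1)) *
            ((Measure.pi fun i : Fin s =>
              Measure.pi fun a : Fin d => gaussianReal (ν i a) v) S).toReal
          + δ := by
  intro S hS
  have hv : v ≠ 0 := by
    rintro rfl
    have : (0 : ℝ) < σ ^ 2 := by positivity
    simp at hv2
    exact this.ne hv2
  have hgood := aux_good_pi (γ := γ) (by linarith)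
    (fun i : Fin s => Measure.pi fun a : Fin d => gaussianReal (μ i a) v)
    (fun i : Fin s => Measure.pi fun a : Fin d => gaussianReal (ν i a) v) _
    (fun i => aux_good_pi (γ := γ) (by linarith) _ _ _
      (fun a => aux_good_gaussian γ (μ i a) (ν i a) v hv))
  have hdp := aux_good_dp γ ((s : ℝ) * γ / σ ^ 2 + Real.log (1 / δ) / (γ - 1)) _ hγ _ _ hgood S hS
  refine hdp.trans (add_le_add le_rfl ?_)
  have hσ2 : 0 < σ ^ 2 := by positivity
  have hγ1 : 0 < γ - 1 := by linarith
  have hc : ∑ i : Fin s, ∑ a : Fin d, γ * (γ - 1) * (μ i a - ν i a) ^ 2 / (2 * σ ^ 2)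
      ≤ (s : ℝ) * γ / σ ^ 2 * (γ - 1) := by
    calc _ ≤ ∑ i : Fin s, γ * (γ - 1) / σ ^ 2 := by
          refine Finset.sum_le_sum fun i _ => ?_
          have h0 : 0 ≤ γ * (γ - 1) / (2 * σ ^ 2) := by positivity
          calc ∑ a : Fin d, γ * (γ - 1) * (μ i a - ν i a) ^ 2 / (2 * σ ^ 2)
              = γ * (γ - 1) / (2 * σ ^ 2) * ∑ a : Fin d, (μ i a - ν i a) ^ 2 := by
                rw [Finset.mul_sum]
                exact Finset.sum_congr rfl fun a _ => by ring
            _ ≤ γ * (γ - 1) / (2 * σ ^ 2) * 2 := mul_le_mul_of_nonneg_left (hsens i) h0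
            _ = _ := by field_simp
      _ = _ := by
          rw [Finset.sum_const, Finset.card_univ, Fintype.card_fin, nsmul_eq_mul]
          ring
  have hlog : Real.log (1 / δ) / (γ - 1) * (γ - 1) = - Real.log δ := by
    rw [div_mul_cancel₀ _ hγ1.ne', one_div, Real.log_inv]
  calc _ ≤ Real.exp (Real.log δ) := by
        refine Real.exp_le_exp.2 ?_
        rw [add_mul, hlog]
        rw [hv2]
        linarith
    _ = δ := Real.exp_log hδ0

/-- **Privacy of SF-PATE.** Let `P` and `Q` be the output distributions of `s` Gaussian-noise
voting queries on two adjacent datasets: products over `i ∈ Fin s` and a ∈ Fin d` of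
Gaussians with variance `σ²`, whose per-query mean (count) vectors differ by at most `√2`
in ℓ₂ norm. Then for every measurable set `S`,
`P(S) ≤ exp(s·γ/σ² + log(1/δ)/(γ − 1)) · Q(S) + δ`, i.e. SF-PATE satisfies
`(s·γ/σ² + log(1/δ)/(γ − 1), δ)`-differential privacy. -/
theorem sf_pate_dp
    (γ σ δ : ℝ) (hγ : 1 < γ) (hσ : 0 < σ) (hδ0 : 0 < δ) (hδ1 : δ < 1)
    (s d : ℕ) (μ ν : Fin s → Fin d → ℝ)
    (hsens : ∀ i : Fin s, ∑ a : Fin d, (μ i a - ν i a) ^ 2 ≤ 2) :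
    ∀ S : Set (Fin s → Fin d → ℝ), MeasurableSet S →
      ((Measure.pi fun i : Fin s =>
          Measure.pi fun a : Fin d => gaussianReal (μ i a) ⟨σ ^ 2, sq_nonneg σ⟩) S).toReal
        ≤ Real.exp ((s : ℝ) * γ / σ ^ 2 + Real.log (1 / δ) / (γ - 1)) *
            ((Measure.pi fun i : Fin s =>
              Measure.pi fun a : Fin d => gaussianReal (ν i a) ⟨σ ^ 2, sq_nonneg σ⟩) S).toReal
          + δ := by
  exact aux_main γ σ δ hγ hσ hδ0 hδ1 s d μ ν ⟨σ ^ 2, sq_nonneg σ⟩ rfl hsens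
end
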